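/- arXiv:2211.09665 — 8 statements merged into one kernel-verified Lean document; each statement's English description precedes it below -/
import Mathlib

section
/- The sets Exclude_1, Exclude_2, ..., Exclude_n form a partition of X: they are pairwise disjoint and their union equals X. -/
/- A 0-1 knapsack solution is modeled as the finset `S ⊆ {1,…,n}` of selected item
indices (so `x_i = 1 ↔ i ∈ S`). -/

/-- Total weight of a solution. -/
def totalWeight (w : ℕ → ℕ) (S : Finset ℕ) : ℕ := ∑ i ∈ S, w i

/-- `S` is an inclusionwise maximal solution (IMS). -/
def IsIMS (n c : ℕ) (w : ℕ → ℕ) (S : Finset ℕ) : Prop :=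
  S ⊆ Finset.Icc 1 n ∧ totalWeight w S ≤ c ∧
    ¬ ∃ j, 1 ≤ j ∧ j ≤ n ∧ j ∉ S ∧ w j + totalWeight w S ≤ c

/-- `Exclude_i`: IMSs for which item `i` is the least heavy unselected item. -/
def Exclude (n c : ℕ) (w : ℕ → ℕ) (i : ℕ) (S : Finset ℕ) : Prop :=
  IsIMS n c w S ∧ i ∉ S ∧ ∀ j, i + 1 ≤ j → j ≤ n → j ∈ S

theorem stmt_1 (n c : ℕ) (w p : ℕ → ℕ)
    (hn : 1 ≤ n) (hc : 1 ≤ c)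
    (hwpos : ∀ i, 1 ≤ i → i ≤ n → 1 ≤ w i)
    (hppos : ∀ i, 1 ≤ i → i ≤ n → 1 ≤ p i)
    (hmono : ∀ i j, 1 ≤ i → i ≤ j → j ≤ n → w j ≤ w i)
    (hsum : c < ∑ i ∈ Finset.Icc 1 n, w i)
    (hwle : ∀ i, 1 ≤ i → i ≤ n → w i ≤ c) :
    (∀ i j, 1 ≤ i → i ≤ n → 1 ≤ j → j ≤ n → i ≠ j →
      Disjoint {S : Finset ℕ | Exclude n c w i S} {S : Finset ℕ | Exclude n c w j S})
    ∧
    (⋃ i ∈ Set.Icc 1 n, {S : Finset ℕ | Exclude n c w i S})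
      = {S : Finset ℕ | IsIMS n c w S} := by
  constructor
  · intro i j hi hin hj hjn hij
    rw [Set.disjoint_left]
    rintro S ⟨-, hiS, hi'⟩ ⟨-, hjS, hj'⟩
    rcases Nat.lt_or_gt_of_ne hij with h | h
    · exact hjS (hi' j h hjn)
    · exact hiS (hj' i h hin)
  · ext S
    simp only [Set.mem_iUnion, Set.mem_ofPred_eq, exists_prop]
    constructor
    · rintro ⟨i, -, h⟩
      exact h.1
    · intro hS
      have hne : (Finset.Icc 1 n \ S).Nonempty := by
        rw [Finset.sdiff_nonempty]
        intro hsub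
        have hle := hS.2.1
        rw [hS.1.antisymm hsub] at hle
        exact absurd hle (not_le.mpr hsum)
      have hmem := Finset.max'_mem _ hne
      rw [Finset.mem_sdiff, Finset.mem_Icc] at hmem
      refine ⟨_, hmem.1, hS, hmem.2, fun j hj hjn => ?_⟩
      by_contra hjS
      have hle := Finset.le_max' (Finset.Icc 1 n \ S) j
        (Finset.mem_sdiff.mpr ⟨Finset.mem_Icc.mpr ⟨by lia, hjn⟩, hjS⟩)
      lia
end

section
/- For every index i with 1 ≤ i ≤ n and every integer k, the number of solutions x ∈ Exclude_i with totalWeight(x) = k equals numberSubsetsWeight(i, k - ∑_{j=i+1}^n w_j) if c + 1 - w_i ≤ k ≤ c, and equals 0 otherwise. -/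
/-- The number of subsets `A ⊆ {1,…,i-1}` whose weights sum to `k`. -/
noncomputable def numberSubsetsWeight (w : ℕ → ℕ) (i : ℕ) (k : ℤ) : ℕ :=
  {A : Finset ℕ | A ⊆ Finset.Icc 1 (i - 1) ∧ ∑ j ∈ A, (w j : ℤ) = k}.ncard

/-- A knapsack solution lies in `Exclude_i` exactly when it consists of a set of items
before `i` together with all items after `i`, and leaves a gap smaller than `w i`. -/
theorem exclude_iff {n c : ℕ} {w : ℕ → ℕ}
    (hmono : ∀ i j, 1 ≤ i → i ≤ j → j ≤ n → w j ≤ w i)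
    {i : ℕ} (hi1 : 1 ≤ i) (hin : i ≤ n) (S : Finset ℕ) :
    Exclude n c w i S ↔ (∃ A ⊆ Finset.Icc 1 (i - 1), A ∪ Finset.Icc (i + 1) n = S) ∧
      totalWeight w S ≤ c ∧ c < w i + totalWeight w S := by
  constructor
  · rintro ⟨⟨hS, hle, hmax⟩, hi, hall⟩
    refine ⟨⟨S ∩ Finset.Icc 1 (i - 1), Finset.inter_subset_right, ?_⟩, hle, ?_⟩
    · ext j
      have hj := @hS j
      have hj' := hall j
      have hne : j ∈ S → j ≠ i := fun h e => hi (e ▸ h)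
      simp only [Finset.mem_union, Finset.mem_inter, Finset.mem_Icc] at hj ⊢
      grind
    · by_contra! h
      exact hmax ⟨i, hi1, hin, hi, h⟩
  · rintro ⟨⟨A, hA, rfl⟩, hle, hlt⟩
    have hA' : ∀ j ∈ A, 1 ≤ j ∧ j ≤ i - 1 := fun j hj => Finset.mem_Icc.1 (hA hj)
    refine ⟨⟨?_, hle, ?_⟩, ?_, ?_⟩
    · intro j hj
      simp only [Finset.mem_union, Finset.mem_Icc] at hj ⊢
      grind
    · rintro ⟨j, hj1, hjn, hj, h⟩
      simp only [Finset.mem_union, Finset.mem_Icc, not_or] at hj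
      have := hmono j i hj1 (by omega) hin
      omega
    · simp only [Finset.mem_union, Finset.mem_Icc]
      grind
    · intro j h1 h2
      exact Finset.mem_union_right _ (Finset.mem_Icc.2 ⟨h1, h2⟩)

theorem disjoint_Icc_of_subset {A : Finset ℕ} {i n : ℕ} (hA : A ⊆ Finset.Icc 1 (i - 1)) :
    Disjoint A (Finset.Icc (i + 1) n) := by
  rw [Finset.disjoint_left]
  intro j hj hj'
  have := Finset.mem_Icc.1 (hA hj)
  have := Finset.mem_Icc.1 hj'
  omega

theorem stmt_2 (n c : ℕ) (w p : ℕ → ℕ)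
    (hn : 1 ≤ n) (hc : 1 ≤ c)
    (hwpos : ∀ i, 1 ≤ i → i ≤ n → 1 ≤ w i)
    (hppos : ∀ i, 1 ≤ i → i ≤ n → 1 ≤ p i)
    (hmono : ∀ i j, 1 ≤ i → i ≤ j → j ≤ n → w j ≤ w i)
    (hsum : c < ∑ i ∈ Finset.Icc 1 n, w i)
    (hwle : ∀ i, 1 ≤ i → i ≤ n → w i ≤ c)
    (i : ℕ) (hi1 : 1 ≤ i) (hin : i ≤ n) (k : ℤ) :
    {S : Finset ℕ | Exclude n c w i S ∧ (totalWeight w S : ℤ) = k}.ncard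
      = if (c : ℤ) + 1 - w i ≤ k ∧ k ≤ c then
          numberSubsetsWeight w i (k - ∑ j ∈ Finset.Icc (i + 1) n, (w j : ℤ))
        else 0 := by
  have hset : {S : Finset ℕ | Exclude n c w i S ∧ (totalWeight w S : ℤ) = k} =
      if (c : ℤ) + 1 - w i ≤ k ∧ k ≤ c then
        (· ∪ Finset.Icc (i + 1) n) '' {A : Finset ℕ | A ⊆ Finset.Icc 1 (i - 1) ∧
          ∑ j ∈ A, (w j : ℤ) = k - ∑ j ∈ Finset.Icc (i + 1) n, (w j : ℤ)}
      else ∅ := by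
    have hweight {A : Finset ℕ} (hA : A ⊆ Finset.Icc 1 (i - 1)) :
        (totalWeight w (A ∪ Finset.Icc (i + 1) n) : ℤ) =
          ∑ j ∈ A, (w j : ℤ) + ∑ j ∈ Finset.Icc (i + 1) n, (w j : ℤ) := by
      rw [totalWeight, Finset.sum_union (disjoint_Icc_of_subset hA)]
      push_cast
      rfl
    ext S
    rw [Set.mem_ofPred_eq, exclude_iff hmono hi1 hin]
    split_ifs with h
    · constructor
      · rintro ⟨⟨⟨A, hA, rfl⟩, -, -⟩, hk⟩
        have := hweight hA
        exact ⟨A, ⟨hA, by omega⟩, rfl⟩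
      · rintro ⟨A, ⟨hA, hk⟩, rfl⟩
        have := hweight hA
        exact ⟨⟨⟨A, hA, rfl⟩, by dsimp only; omega, by dsimp only; omega⟩, by dsimp only; omega⟩
    · simp only [Set.mem_empty_iff_false, iff_false]
      rintro ⟨⟨-, hle, hlt⟩, hk⟩
      omega
  rw [hset]
  split_ifs with h
  · refine Set.InjOn.ncard_image ?_
    rintro A ⟨hA, -⟩ B ⟨hB, -⟩ hAB
    have hAB' := congrArg (· \ Finset.Icc (i + 1) n) hAB
    simpa only [Finset.union_sdiff_cancel_right (disjoint_Icc_of_subset hA),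
      Finset.union_sdiff_cancel_right (disjoint_Icc_of_subset hB)] using hAB'
  · exact Set.ncard_empty _
end

section
/- For every integer k with 1 ≤ k ≤ c, numberIMSWeight(k) = ∑_{i=1}^n T_i(k), where T_i(k) = numberSubsetsWeight(i, k - ∑_{j=i+1}^n w_j) if c + 1 - w_i ≤ k ≤ c, and T_i(k) = 0 otherwise. -/
/-- The number of IMSs with total weight `k`. -/
noncomputable def numberIMSWeight (n c : ℕ) (w : ℕ → ℕ) (k : ℤ) : ℕ :=
  {S : Finset ℕ | IsIMS n c w S ∧ (totalWeight w S : ℤ) = k}.ncard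

/-- A positive `i` is the largest index of `{1,…,n}` missing from `S` iff `i` is missing and all
later indices are selected. -/
theorem sup_missing_eq_iff {n i : ℕ} {S : Finset ℕ} (hi : i ∈ Finset.Icc 1 n) :
    (Finset.Icc 1 n \ S).sup id = i ↔ i ∉ S ∧ Finset.Icc (i + 1) n ⊆ S := by
  rw [Finset.mem_Icc] at hi
  constructor
  · intro h
    have hne : (Finset.Icc 1 n \ S).Nonempty := by
      by_contra hne
      rw [Finset.not_nonempty_iff_eq_empty] at hne
      simp only [hne, Finset.sup_empty, Nat.bot_eq_zero] at h
      omega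
    obtain ⟨m, hm, hmi⟩ := Finset.exists_mem_eq_sup _ hne id
    obtain rfl : i = m := h.symm.trans hmi
    refine ⟨(Finset.mem_sdiff.1 hm).2, fun j hj => ?_⟩
    rw [Finset.mem_Icc] at hj
    by_contra hjS
    have hle : j ≤ (Finset.Icc 1 n \ S).sup id :=
      Finset.le_sup (f := id) (Finset.mem_sdiff.2 ⟨Finset.mem_Icc.2 (by omega), hjS⟩)
    omega
  · rintro ⟨hiS, hS⟩
    apply le_antisymm
    · refine Finset.sup_le fun j hj => ?_
      rw [Finset.mem_sdiff, Finset.mem_Icc] at hj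
      by_contra hij
      exact hj.2 (hS (Finset.mem_Icc.2 ⟨Nat.lt_of_not_le hij, hj.1.2⟩))
    · exact Finset.le_sup (f := id) (Finset.mem_sdiff.2 ⟨Finset.mem_Icc.2 hi, hiS⟩)

/-- If `i` is the last missing index of `S`, maximality only has to be tested at `i`, since the
weights are non-increasing. -/
theorem isIMS_iff_of_last_missing {n c i : ℕ} {w : ℕ → ℕ} {S : Finset ℕ}
    (hmono : ∀ i j, 1 ≤ i → i ≤ j → j ≤ n → w j ≤ w i) (hi : i ∈ Finset.Icc 1 n)
    (hiS : i ∉ S) (hS : Finset.Icc (i + 1) n ⊆ S) :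
    IsIMS n c w S ↔
      S ⊆ Finset.Icc 1 n ∧ totalWeight w S ≤ c ∧ c < w i + totalWeight w S := by
  rw [Finset.mem_Icc] at hi
  refine and_congr_right fun _ => and_congr_right fun _ => ⟨fun h => ?_, ?_⟩
  · by_contra hlt
    exact h ⟨i, hi.1, hi.2, hiS, Nat.le_of_not_lt hlt⟩
  · rintro hlt ⟨j, hj1, hjn, hjS, hjc⟩
    have hji : j ≤ i := by
      by_contra hij
      exact hjS (hS (Finset.mem_Icc.2 ⟨Nat.lt_of_not_le hij, hjn⟩))
    have := hmono j i hj1 hji hi.2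
    omega

/-- Subsets of `{1,…,n}` of weight `k` with last missing index `i` correspond to subsets of
`{1,…,i-1}` of weight `k - ∑_{j>i} w_j`. -/
theorem ncard_last_missing {n i : ℕ} (w : ℕ → ℕ) (k : ℤ) (hi : i ∈ Finset.Icc 1 n) :
    {S : Finset ℕ | S ⊆ Finset.Icc 1 n ∧ i ∉ S ∧ Finset.Icc (i + 1) n ⊆ S ∧
        (totalWeight w S : ℤ) = k}.ncard
      = numberSubsetsWeight w i (k - ∑ j ∈ Finset.Icc (i + 1) n, (w j : ℤ)) := by
  rw [Finset.mem_Icc] at hi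
  have hdisj : ∀ A ⊆ Finset.Icc 1 (i - 1), Disjoint A (Finset.Icc (i + 1) n) := by
    intro A hA
    refine Finset.disjoint_left.2 fun a ha ha' => ?_
    have := Finset.mem_Icc.1 (hA ha)
    have := Finset.mem_Icc.1 ha'
    omega
  symm
  unfold numberSubsetsWeight
  refine Set.ncard_congr (fun A _ => A ∪ Finset.Icc (i + 1) n) ?_ ?_ ?_
  · rintro A ⟨hA, hAk⟩
    refine ⟨fun a ha => ?_, fun ha => ?_, Finset.subset_union_right, ?_⟩
    · rcases Finset.mem_union.1 ha with ha | ha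
      · have := Finset.mem_Icc.1 (hA ha)
        exact Finset.mem_Icc.2 (by omega)
      · have := Finset.mem_Icc.1 ha
        exact Finset.mem_Icc.2 (by omega)
    · rcases Finset.mem_union.1 ha with ha | ha
      · have := Finset.mem_Icc.1 (hA ha)
        omega
      · have := Finset.mem_Icc.1 ha
        omega
    · rw [totalWeight, Nat.cast_sum, Finset.sum_union (hdisj A hA), hAk]
      ring
  · rintro A B ⟨hA, -⟩ ⟨hB, -⟩ hAB
    rw [← Finset.union_sdiff_cancel_right (hdisj A hA), hAB,
      Finset.union_sdiff_cancel_right (hdisj B hB)]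
  · rintro S ⟨hSn, hiS, hS, hSk⟩
    refine ⟨S \ Finset.Icc (i + 1) n, ⟨fun a ha => ?_, ?_⟩, Finset.sdiff_union_of_subset hS⟩
    · rw [Finset.mem_sdiff, Finset.mem_Icc] at ha
      have := Finset.mem_Icc.1 (hSn ha.1)
      have hai : a ≠ i := fun h => hiS (h ▸ ha.1)
      exact Finset.mem_Icc.2 (by omega)
    · rw [← hSk, totalWeight, Nat.cast_sum, ← Finset.sum_sdiff hS]
      ring

theorem stmt_3 (n c : ℕ) (w p : ℕ → ℕ)
    (hn : 1 ≤ n) (hc : 1 ≤ c)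
    (hwpos : ∀ i, 1 ≤ i → i ≤ n → 1 ≤ w i)
    (hppos : ∀ i, 1 ≤ i → i ≤ n → 1 ≤ p i)
    (hmono : ∀ i j, 1 ≤ i → i ≤ j → j ≤ n → w j ≤ w i)
    (hsum : c < ∑ i ∈ Finset.Icc 1 n, w i)
    (hwle : ∀ i, 1 ≤ i → i ≤ n → w i ≤ c)
    (k : ℤ) (hk1 : 1 ≤ k) (hkc : k ≤ c) :
    numberIMSWeight n c w k
      = ∑ i ∈ Finset.Icc 1 n,
          (if (c : ℤ) + 1 - w i ≤ k ∧ k ≤ c then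
            numberSubsetsWeight w i (k - ∑ j ∈ Finset.Icc (i + 1) n, (w j : ℤ))
          else 0) := by
  classical
  have hset : {S : Finset ℕ | IsIMS n c w S ∧ (totalWeight w S : ℤ) = k}
      = ↑((Finset.Icc 1 n).powerset.filter
          fun S => IsIMS n c w S ∧ (totalWeight w S : ℤ) = k) := by
    ext S
    simp only [Set.mem_ofPred_eq, Finset.coe_filter, Finset.mem_powerset]
    exact ⟨fun h => ⟨h.1.1, h⟩, fun h => h.2⟩
  rw [numberIMSWeight, hset, Set.ncard_coe_finset,
    Finset.card_eq_sum_card_fiberwise (f := fun S => (Finset.Icc 1 n \ S).sup id)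
      (t := Finset.Icc 1 n)]
  · refine Finset.sum_congr rfl fun i hi => ?_
    rw [← Set.ncard_coe_finset]
    split_ifs with hcond
    · rw [← ncard_last_missing w k hi]
      congr 1
      ext S
      simp only [Finset.coe_filter, Finset.mem_filter, Finset.mem_powerset, Set.mem_ofPred_eq,
        sup_missing_eq_iff hi]
      constructor
      · rintro ⟨⟨hSn, -, hSk⟩, hiS, hS⟩
        exact ⟨hSn, hiS, hS, hSk⟩
      · rintro ⟨hSn, hiS, hS, hSk⟩
        refine ⟨⟨hSn, (isIMS_iff_of_last_missing hmono hi hiS hS).2 ⟨hSn, ?_, ?_⟩, hSk⟩,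
          hiS, hS⟩ <;> omega
    · rw [Set.ncard_coe_finset, Finset.card_eq_zero, Finset.filter_eq_empty_iff]
      intro S hS hSi
      have hIMS := (Finset.mem_filter.1 hS).2
      obtain ⟨hiS, hsub⟩ := (sup_missing_eq_iff hi).1 hSi
      have := (isIMS_iff_of_last_missing hmono hi hiS hsub).1 hIMS.1
      omega
  · intro S hS
    obtain ⟨hSn, hIMS, -⟩ := Finset.mem_filter.1 hS
    have hne : (Finset.Icc 1 n \ S).Nonempty := by
      refine Finset.sdiff_nonempty.2 fun hsub => ?_
      have hle := hIMS.2.1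
      rw [(Finset.mem_powerset.1 hSn).antisymm hsub, totalWeight] at hle
      omega
    obtain ⟨m, hm, hmi⟩ := Finset.exists_mem_eq_sup _ hne id
    change (Finset.Icc 1 n \ S).sup id ∈ Finset.Icc 1 n
    rw [hmi]
    exact (Finset.mem_sdiff.1 hm).1
end

section
/- Every inclusionwise maximal solution x satisfies totalWeight(x) ≥ c - w_b + 1, where b = max{e ∈ {1,...,n} : ∑_{i=e}^n w_i > c}. -/
theorem stmt_5 (n c : ℕ) (w p : ℕ → ℕ)
    (hn : 1 ≤ n) (hc : 1 ≤ c)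
    (hwpos : ∀ i, 1 ≤ i → i ≤ n → 1 ≤ w i)
    (hppos : ∀ i, 1 ≤ i → i ≤ n → 1 ≤ p i)
    (hmono : ∀ i j, 1 ≤ i → i ≤ j → j ≤ n → w j ≤ w i)
    (hsum : c < ∑ i ∈ Finset.Icc 1 n, w i)
    (hwle : ∀ i, 1 ≤ i → i ≤ n → w i ≤ c)
    -- `b = max{e ∈ {1,…,n} : ∑_{i=e}^n w_i > c}`
    (b : ℕ) (hb1 : 1 ≤ b) (hbn : b ≤ n)
    (hbmem : c < ∑ i ∈ Finset.Icc b n, w i)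
    (hbmax : ∀ e, 1 ≤ e → e ≤ n → c < ∑ i ∈ Finset.Icc e n, w i → e ≤ b)
    (S : Finset ℕ) (hS : IsIMS n c w S) :
    (c : ℤ) - w b + 1 ≤ (totalWeight w S : ℤ) := by
  obtain ⟨-, hfeas, hmax⟩ := hS
  obtain ⟨j, hj, hjS⟩ : ∃ j ∈ Finset.Icc b n, j ∉ S := by
    by_contra! hsub
    have hle : ∑ i ∈ Finset.Icc b n, w i ≤ totalWeight w S := Finset.sum_le_sum_of_subset hsub
    omega
  obtain ⟨hbj, hjn⟩ := Finset.mem_Icc.mp hj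
  have hlt : c < w j + totalWeight w S := by
    by_contra! hle
    exact hmax ⟨j, hb1.trans hbj, hjn, hjS, hle⟩
  have hwj := hmono b j hb1 hbj hjn
  omega
end

section
/- Every vector x ∈ ℝ^n with 0 ≤ x_j ≤ 1 for all j and c - w_b + 1 ≤ ∑_{i=1}^n w_i x_i ≤ c satisfies ∑_{i=1}^n p_i x_i ≥ ∑_{i=1}^{f-1} p_{π_i} + ((c - w_b + 1 - ∑_{i=1}^{f-1} w_{π_i}) / w_{π_f}) · p_{π_f}. -/
/-- If the items in `t` have efficiency at most `r` and those in `s \ t` at least `r`, then every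
fractional vector of weight at least `C` has profit at least that of filling up `t` at rate `r`. -/
theorem sum_add_mul_le_sum_mul_of_threshold {ι : Type*} {s t : Finset ι} (hts : t ⊆ s)
    {w p x : ι → ℝ} {r C : ℝ} (hr : 0 ≤ r)
    (hlow : ∀ i ∈ t, p i ≤ r * w i) (hhigh : ∀ i ∈ s, i ∉ t → r * w i ≤ p i)
    (hx0 : ∀ i ∈ s, 0 ≤ x i) (hx1 : ∀ i ∈ s, x i ≤ 1)
    (hC : C ≤ ∑ i ∈ s, w i * x i) :
    ∑ i ∈ t, p i + (C - ∑ i ∈ t, w i) * r ≤ ∑ i ∈ s, p i * x i := by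
  have hin : ∑ i ∈ t, (p i - r * w i) ≤ ∑ i ∈ t, (p i - r * w i) * x i :=
    Finset.sum_le_sum fun i hi => by
      nlinarith [mul_nonneg (sub_nonneg.2 (hlow i hi)) (sub_nonneg.2 (hx1 i (hts hi)))]
  have hout : ∑ i ∈ t, (p i - r * w i) * x i ≤ ∑ i ∈ s, (p i - r * w i) * x i :=
    Finset.sum_le_sum_of_subset_of_nonneg hts fun i hi hit =>
      mul_nonneg (sub_nonneg.2 (hhigh i hi hit)) (hx0 i hi)
  have hsplit : ∑ i ∈ s, (p i - r * w i) * x i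
      = ∑ i ∈ s, p i * x i - r * ∑ i ∈ s, w i * x i := by
    simp only [sub_mul, mul_assoc, Finset.sum_sub_distrib, Finset.mul_sum]
  rw [Finset.sum_sub_distrib, ← Finset.mul_sum] at hin
  linarith [mul_le_mul_of_nonneg_left hC hr]

/-- Reindexing a finite sum along a bijection between finsets. -/
theorem Set.BijOn.finset_sum_comp {ι κ M : Type*} [AddCommMonoid M] {s : Finset ι} {t : Finset κ}
    {e : ι → κ} (he : Set.BijOn e s t) (g : κ → M) :
    ∑ i ∈ s, g (e i) = ∑ j ∈ t, g j :=
  Finset.sum_nbij e (fun _ hi => he.mapsTo hi) he.injOn he.surjOn fun _ _ => rfl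

theorem stmt_7 (n c : ℕ) (w p : ℕ → ℕ)
    (hn : 1 ≤ n) (hc : 1 ≤ c)
    (hwpos : ∀ i, 1 ≤ i → i ≤ n → 1 ≤ w i)
    (hppos : ∀ i, 1 ≤ i → i ≤ n → 1 ≤ p i)
    (hmono : ∀ i j, 1 ≤ i → i ≤ j → j ≤ n → w j ≤ w i)
    (hsum : c < ∑ i ∈ Finset.Icc 1 n, w i)
    (hwle : ∀ i, 1 ≤ i → i ≤ n → w i ≤ c)
    -- `b = max{e ∈ {1,…,n} : ∑_{i=e}^n w_i > c}`
    (b : ℕ) (hb1 : 1 ≤ b) (hbn : b ≤ n)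
    (hbmem : c < ∑ i ∈ Finset.Icc b n, w i)
    (hbmax : ∀ e, 1 ≤ e → e ≤ n → c < ∑ i ∈ Finset.Icc e n, w i → e ≤ b)
    -- `π` is a permutation of `{1,…,n}` sorting the items by efficiency
    (π : ℕ → ℕ) (hπ : Set.BijOn π (Set.Icc 1 n) (Set.Icc 1 n))
    (hsorted : ∀ i, 1 ≤ i → i + 1 ≤ n →
      (p (π i) : ℝ) / (w (π i) : ℝ) ≤ (p (π (i + 1)) : ℝ) / (w (π (i + 1)) : ℝ))
    -- `f = min{e ∈ {1,…,n} : ∑_{i=1}^e w_{π_i} ≥ c - w_b + 1}`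
    (f : ℕ) (hf1 : 1 ≤ f) (hfn : f ≤ n)
    (hfmem : (c : ℝ) - w b + 1 ≤ ∑ i ∈ Finset.Icc 1 f, (w (π i) : ℝ))
    (hfmin : ∀ e, 1 ≤ e → e ≤ n →
      (c : ℝ) - w b + 1 ≤ ∑ i ∈ Finset.Icc 1 e, (w (π i) : ℝ) → f ≤ e)
    -- a real vector in `[0,1]^n` whose weight lies in `[c - w_b + 1, c]`
    (x : ℕ → ℝ) (hx0 : ∀ j, 1 ≤ j → j ≤ n → 0 ≤ x j) (hx1 : ∀ j, 1 ≤ j → j ≤ n → x j ≤ 1)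
    (hxlo : (c : ℝ) - w b + 1 ≤ ∑ i ∈ Finset.Icc 1 n, (w i : ℝ) * x i)
    (hxhi : ∑ i ∈ Finset.Icc 1 n, (w i : ℝ) * x i ≤ c) :
    ∑ i ∈ Finset.Icc 1 n, (p i : ℝ) * x i
      ≥ ∑ i ∈ Finset.Icc 1 (f - 1), (p (π i) : ℝ)
        + (((c : ℝ) - w b + 1 - ∑ i ∈ Finset.Icc 1 (f - 1), (w (π i) : ℝ)) / (w (π f) : ℝ))
            * (p (π f) : ℝ) := by
  have hmem : ∀ i ∈ Finset.Icc 1 n, 1 ≤ π i ∧ π i ≤ n := fun i hi =>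
    hπ.mapsTo (Finset.mem_Icc.1 hi)
  have hw : ∀ i ∈ Finset.Icc 1 n, (0 : ℝ) < w (π i) := fun i hi =>
    Nat.cast_pos.2 (hwpos _ (hmem i hi).1 (hmem i hi).2)
  have heff : ∀ i j, 1 ≤ i → i ≤ j → j ≤ n →
      (p (π i) : ℝ) / w (π i) ≤ (p (π j) : ℝ) / w (π j) := by
    intro i j hi hij
    induction j, hij using Nat.le_induction with
    | base => exact fun _ => le_rfl
    | succ j hij ih => exact fun hj => (ih (by omega)).trans (hsorted j (by omega) hj)
  rw [← Finset.coe_Icc] at hπ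
  rw [ge_iff_le, ← hπ.finset_sum_comp (fun i => (p i : ℝ) * x i), div_mul_eq_mul_div,
    mul_div_assoc]
  rw [← hπ.finset_sum_comp (fun i => (w i : ℝ) * x i)] at hxlo
  refine sum_add_mul_le_sum_mul_of_threshold (w := fun i => (w (π i) : ℝ))
    (p := fun i => (p (π i) : ℝ)) (x := fun i => x (π i))
    (Finset.Icc_subset_Icc_right (by omega)) (by positivity) ?_ ?_
    (fun i hi => hx0 _ (hmem i hi).1 (hmem i hi).2)
    (fun i hi => hx1 _ (hmem i hi).1 (hmem i hi).2) hxlo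
  · intro i hi
    rw [Finset.mem_Icc] at hi
    exact (div_le_iff₀ (hw i (Finset.mem_Icc.2 (by omega)))).1
      (heff i f hi.1 (by omega) hfn)
  · intro i hi hif
    rw [Finset.mem_Icc] at hif
    have hi' := Finset.mem_Icc.1 hi
    exact (le_div_iff₀ (hw i hi)).1 (heff f i hf1 (by omega) hi'.2)
end

section
/- Every inclusionwise maximal solution x = (x_1, ..., x_n) satisfies ∑_{i=1}^n p_i x_i ≥ ∑_{i=1}^{f-1} p_{π_i} + ((c - w_b + 1 - ∑_{i=1}^{f-1} w_{π_i}) / w_{π_f}) · p_{π_f}. -/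
/-- Every inclusionwise maximal solution has total weight greater than `c - w b`. -/
lemma IsIMS.lt_add_totalWeight {n c b : ℕ} {w : ℕ → ℕ} {S : Finset ℕ} (hS : IsIMS n c w S)
    (hmono : ∀ i j, 1 ≤ i → i ≤ j → j ≤ n → w j ≤ w i) (hb : 1 ≤ b)
    (hbmem : c < ∑ i ∈ Finset.Icc b n, w i) : c < w b + totalWeight w S := by
  obtain ⟨-, hle, hmax⟩ := hS
  have hsub : ¬ Finset.Icc b n ⊆ S := fun h =>
    (hbmem.trans_le (Finset.sum_le_sum_of_subset h)).not_ge hle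
  obtain ⟨j, hj, hjS⟩ := Finset.not_subset.mp hsub
  rw [Finset.mem_Icc] at hj
  have hlt : c < w j + totalWeight w S := by
    by_contra! h
    exact hmax ⟨j, hb.trans hj.1, hj.2, hjS, h⟩
  have := hmono b j hb hj.1 hj.2
  omega

/-- If `g ≤ 0` on `F` and `0 ≤ g` on `S \ F`, then the sum of `g` over `F` is at most the one
over `S`. -/
lemma Finset.sum_le_sum_of_nonpos_of_nonneg_sdiff {ι : Type*} [DecidableEq ι] {F S : Finset ι}
    {g : ι → ℝ} (hF : ∀ i ∈ F, g i ≤ 0) (hS : ∀ i ∈ S \ F, 0 ≤ g i) :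
    ∑ i ∈ F, g i ≤ ∑ i ∈ S, g i := by
  rw [← Finset.sum_inter_add_sum_sdiff F S g, ← Finset.sum_inter_add_sum_sdiff S F g,
    Finset.inter_comm S F]
  have h₁ : ∑ i ∈ F \ S, g i ≤ 0 :=
    Finset.sum_nonpos fun i hi => hF i (Finset.mem_sdiff.mp hi).1
  have h₂ : 0 ≤ ∑ i ∈ S \ F, g i := Finset.sum_nonneg hS
  linarith

theorem stmt_8 (n c : ℕ) (w p : ℕ → ℕ)
    (hn : 1 ≤ n) (hc : 1 ≤ c)
    (hwpos : ∀ i, 1 ≤ i → i ≤ n → 1 ≤ w i)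
    (hppos : ∀ i, 1 ≤ i → i ≤ n → 1 ≤ p i)
    (hmono : ∀ i j, 1 ≤ i → i ≤ j → j ≤ n → w j ≤ w i)
    (hsum : c < ∑ i ∈ Finset.Icc 1 n, w i)
    (hwle : ∀ i, 1 ≤ i → i ≤ n → w i ≤ c)
    -- `b = max{e ∈ {1,…,n} : ∑_{i=e}^n w_i > c}`
    (b : ℕ) (hb1 : 1 ≤ b) (hbn : b ≤ n)
    (hbmem : c < ∑ i ∈ Finset.Icc b n, w i)
    (hbmax : ∀ e, 1 ≤ e → e ≤ n → c < ∑ i ∈ Finset.Icc e n, w i → e ≤ b)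
    -- `π` is a permutation of `{1,…,n}` sorting the items by efficiency
    (π : ℕ → ℕ) (hπ : Set.BijOn π (Set.Icc 1 n) (Set.Icc 1 n))
    (hsorted : ∀ i, 1 ≤ i → i + 1 ≤ n →
      (p (π i) : ℝ) / (w (π i) : ℝ) ≤ (p (π (i + 1)) : ℝ) / (w (π (i + 1)) : ℝ))
    -- `f = min{e ∈ {1,…,n} : ∑_{i=1}^e w_{π_i} ≥ c - w_b + 1}`
    (f : ℕ) (hf1 : 1 ≤ f) (hfn : f ≤ n)
    (hfmem : (c : ℝ) - w b + 1 ≤ ∑ i ∈ Finset.Icc 1 f, (w (π i) : ℝ))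
    (hfmin : ∀ e, 1 ≤ e → e ≤ n →
      (c : ℝ) - w b + 1 ≤ ∑ i ∈ Finset.Icc 1 e, (w (π i) : ℝ) → f ≤ e)
    (S : Finset ℕ) (hS : IsIMS n c w S) :
    ∑ i ∈ S, (p i : ℝ)
      ≥ ∑ i ∈ Finset.Icc 1 (f - 1), (p (π i) : ℝ)
        + (((c : ℝ) - w b + 1 - ∑ i ∈ Finset.Icc 1 (f - 1), (w (π i) : ℝ)) / (w (π f) : ℝ))
            * (p (π f) : ℝ) := by
  have hweight : (c : ℝ) - w b + 1 ≤ ∑ i ∈ S, (w i : ℝ) := by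
    have h : c + 1 ≤ w b + ∑ i ∈ S, w i := hS.lt_add_totalWeight hmono hb1 hbmem
    have h' : (c : ℝ) + 1 ≤ w b + ∑ i ∈ S, (w i : ℝ) := by exact_mod_cast h
    linarith
  have heff : ∀ i j, 1 ≤ i → i ≤ j → j ≤ n →
      (p (π i) : ℝ) / (w (π i) : ℝ) ≤ (p (π j) : ℝ) / (w (π j) : ℝ) := by
    intro i j hi hij
    induction j, hij using Nat.le_induction with
    | base => exact fun _ => le_rfl
    | succ k hik ih =>
      exact fun hk => (ih (by omega)).trans (hsorted k (hi.trans hik) hk)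
  have hwπ : ∀ i, 1 ≤ i → i ≤ n → (0 : ℝ) < w (π i) := by
    intro i hi hin
    have h := hπ.mapsTo (Set.mem_Icc.mpr ⟨hi, hin⟩)
    exact_mod_cast hwpos (π i) h.1 h.2
  set r : ℝ := (p (π f) : ℝ) / (w (π f) : ℝ) with hr
  have hr0 : 0 ≤ r := by positivity
  have hinj : Set.InjOn π (Finset.Icc 1 (f - 1) : Finset ℕ) := by
    refine hπ.injOn.mono fun i hi => ?_
    simp only [Finset.coe_Icc, Set.mem_Icc] at hi ⊢
    omega
  have hgreedy : ∑ i ∈ (Finset.Icc 1 (f - 1)).image π, ((p i : ℝ) - r * w i)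
      ≤ ∑ i ∈ S, ((p i : ℝ) - r * w i) := by
    apply Finset.sum_le_sum_of_nonpos_of_nonneg_sdiff
    · simp only [Finset.mem_image, Finset.mem_Icc]
      rintro _ ⟨i, hi, rfl⟩
      rw [sub_nonpos, ← div_le_iff₀ (hwπ i hi.1 (by omega))]
      exact heff i f hi.1 (by omega) hfn
    · intro j hj
      rw [Finset.mem_sdiff] at hj
      obtain ⟨i, hi, rfl⟩ := hπ.surjOn (Finset.mem_Icc.mp (hS.1 hj.1))
      have hfi : f ≤ i := by
        by_contra! h
        exact hj.2 (Finset.mem_image_of_mem π (Finset.mem_Icc.mpr ⟨hi.1, by omega⟩))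
      rw [sub_nonneg, ← le_div_iff₀ (hwπ i hi.1 hi.2)]
      exact heff f i hf1 hfi hi.2
  rw [Finset.sum_image hinj, Finset.sum_sub_distrib, Finset.sum_sub_distrib, ← Finset.mul_sum,
    ← Finset.mul_sum] at hgreedy
  rw [ge_iff_le, div_mul_eq_mul_div, mul_div_assoc, ← hr]
  have := mul_le_mul_of_nonneg_left hweight hr0
  linarith
end

section
/- Let x = (x_1, ..., x_n) be an inclusionwise maximal solution, let x* = (x_1*, ..., x_n*) be a feasible binary solution maximizing ∑_{i=1}^n p_i x_i* over all feasible binary solutions, and let UB be a real number with UB ≥ ∑_{i=1}^n p_i x_i* and UB > 0. Then (∑_{i=1}^n p_i x_i) / (∑_{i=1}^n p_i x_i*) ≥ (∑_{i=1}^{f-1} p_{π_i} + ((c - w_b + 1 - ∑_{i=1}^{f-1} w_{π_i}) / w_{π_f}) · p_{π_f}) / UB. -/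
/-- A maximal solution misses an item of weight at most `w b`, so its weight exceeds `c - w b`. -/
theorem IsIMS.lt_totalWeight_add {n c b : ℕ} {w : ℕ → ℕ} {S : Finset ℕ} (hS : IsIMS n c w S)
    (hmono : ∀ i j, 1 ≤ i → i ≤ j → j ≤ n → w j ≤ w i) (hb : 1 ≤ b)
    (hbmem : c < ∑ i ∈ Finset.Icc b n, w i) : c < totalWeight w S + w b := by
  obtain ⟨-, hfeas, hmax⟩ := hS
  obtain ⟨j, hj, hjS⟩ : ∃ j ∈ Finset.Icc b n, j ∉ S := by
    by_contra! h
    exact absurd (hbmem.trans_le (Finset.sum_le_sum_of_subset h)) hfeas.not_gt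
  rw [Finset.mem_Icc] at hj
  have hwj := hmono b j hb hj.1 hj.2
  by_contra! h
  exact hmax ⟨j, hb.trans hj.1, hj.2, hjS, by omega⟩

/-- A sequence with nondecreasing consecutive terms on `{1,…,n}` is monotone there. -/
theorem le_of_le_succ_of_le {n : ℕ} {a : ℕ → ℝ}
    (ha : ∀ i, 1 ≤ i → i + 1 ≤ n → a i ≤ a (i + 1)) {i j : ℕ}
    (hi : 1 ≤ i) (hij : i ≤ j) (hj : j ≤ n) : a i ≤ a j := by
  induction j, hij using Nat.le_induction with
  | base => exact le_rfl
  | succ k hk ih => exact (ih (by omega)).trans (ha k (hi.trans hk) hj)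

/-- If `g ∘ π` is nonnegative from position `f` on, then no subset of `{1,…,n}` has a smaller
`g`-sum than the nonpositive items at the positions before `f`. -/
theorem sum_prefix_le_sum {n f : ℕ} {g : ℕ → ℝ} {π : ℕ → ℕ}
    (hπ : Set.BijOn π (Set.Icc 1 n) (Set.Icc 1 n)) (hfn : f ≤ n)
    (hneg : ∀ k, 1 ≤ k → k < f → g (π k) ≤ 0)
    (hpos : ∀ k, 1 ≤ k → f ≤ k → k ≤ n → 0 ≤ g (π k))
    {S : Finset ℕ} (hS : S ⊆ Finset.Icc 1 n) :
    ∑ k ∈ Finset.Icc 1 (f - 1), g (π k) ≤ ∑ i ∈ S, g i := by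
  calc ∑ k ∈ Finset.Icc 1 (f - 1), g (π k)
      = ∑ k ∈ Finset.Icc 1 (f - 1), min (g (π k)) 0 := by
        refine Finset.sum_congr rfl fun k hk => ?_
        rw [Finset.mem_Icc] at hk
        exact (min_eq_left (hneg k hk.1 (by omega))).symm
    _ = ∑ k ∈ Finset.Icc 1 n, min (g (π k)) 0 := by
        refine Finset.sum_subset (Finset.Icc_subset_Icc_right (by omega)) fun k hk hk' => ?_
        rw [Finset.mem_Icc] at hk hk'
        exact min_eq_right (hpos k hk.1 (by omega) hk.2)
    _ = ∑ i ∈ Finset.Icc 1 n, min (g i) 0 := by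
        rw [← Finset.coe_Icc] at hπ
        exact Finset.sum_nbij (g := fun i => min (g i) 0) π hπ.mapsTo hπ.injOn hπ.surjOn
          fun _ _ => rfl
    _ ≤ ∑ i ∈ S, min (g i) 0 := by
        rw [← Finset.sum_sdiff hS]
        exact add_le_of_nonpos_left (Finset.sum_nonpos fun _ _ => min_le_right _ _)
    _ ≤ ∑ i ∈ S, g i := Finset.sum_le_sum fun _ _ => min_le_left _ _

theorem stmt_9 (n c : ℕ) (w p : ℕ → ℕ)
    (hn : 1 ≤ n) (hc : 1 ≤ c)
    (hwpos : ∀ i, 1 ≤ i → i ≤ n → 1 ≤ w i)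
    (hppos : ∀ i, 1 ≤ i → i ≤ n → 1 ≤ p i)
    (hmono : ∀ i j, 1 ≤ i → i ≤ j → j ≤ n → w j ≤ w i)
    (hsum : c < ∑ i ∈ Finset.Icc 1 n, w i)
    (hwle : ∀ i, 1 ≤ i → i ≤ n → w i ≤ c)
    -- `b = max{e ∈ {1,…,n} : ∑_{i=e}^n w_i > c}`
    (b : ℕ) (hb1 : 1 ≤ b) (hbn : b ≤ n)
    (hbmem : c < ∑ i ∈ Finset.Icc b n, w i)
    (hbmax : ∀ e, 1 ≤ e → e ≤ n → c < ∑ i ∈ Finset.Icc e n, w i → e ≤ b)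
    -- `π` is a permutation of `{1,…,n}` sorting the items by efficiency
    (π : ℕ → ℕ) (hπ : Set.BijOn π (Set.Icc 1 n) (Set.Icc 1 n))
    (hsorted : ∀ i, 1 ≤ i → i + 1 ≤ n →
      (p (π i) : ℝ) / (w (π i) : ℝ) ≤ (p (π (i + 1)) : ℝ) / (w (π (i + 1)) : ℝ))
    -- `f = min{e ∈ {1,…,n} : ∑_{i=1}^e w_{π_i} ≥ c - w_b + 1}`
    (f : ℕ) (hf1 : 1 ≤ f) (hfn : f ≤ n)
    (hfmem : (c : ℝ) - w b + 1 ≤ ∑ i ∈ Finset.Icc 1 f, (w (π i) : ℝ))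
    (hfmin : ∀ e, 1 ≤ e → e ≤ n →
      (c : ℝ) - w b + 1 ≤ ∑ i ∈ Finset.Icc 1 e, (w (π i) : ℝ) → f ≤ e)
    -- `S` is an IMS, `T` is an optimal solution and `UB` an upper bound on its profit
    (S : Finset ℕ) (hS : IsIMS n c w S)
    (T : Finset ℕ) (hT : T ⊆ Finset.Icc 1 n) (hTfeas : totalWeight w T ≤ c)
    (hTopt : ∀ T' : Finset ℕ, T' ⊆ Finset.Icc 1 n → totalWeight w T' ≤ c →
      ∑ i ∈ T', p i ≤ ∑ i ∈ T, p i)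
    (UB : ℝ) (hUB : (∑ i ∈ T, (p i : ℝ)) ≤ UB) (hUBpos : 0 < UB) :
    (∑ i ∈ S, (p i : ℝ)) / (∑ i ∈ T, (p i : ℝ))
      ≥ (∑ i ∈ Finset.Icc 1 (f - 1), (p (π i) : ℝ)
          + (((c : ℝ) - w b + 1 - ∑ i ∈ Finset.Icc 1 (f - 1), (w (π i) : ℝ)) / (w (π f) : ℝ))
              * (p (π f) : ℝ)) / UB := by
  have hW : (c : ℝ) - w b + 1 ≤ ∑ i ∈ S, (w i : ℝ) := by
    have h := hS.lt_totalWeight_add hmono hb1 hbmem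
    have h' : (c : ℝ) + 1 ≤ (∑ i ∈ S, w i : ℕ) + w b := by exact_mod_cast h
    push_cast at h'
    linarith
  have hTpos : 0 < ∑ i ∈ T, (p i : ℝ) := by
    have h1 := hTopt {1} (by simpa using hn) (by simpa [totalWeight] using hwle 1 le_rfl hn)
    rw [Finset.sum_singleton] at h1
    exact_mod_cast (hppos 1 le_rfl hn).trans h1
  set r : ℝ := (p (π f) : ℝ) / w (π f) with hr
  have hr0 : 0 ≤ r := by positivity
  have hwπ : ∀ k, 1 ≤ k → k ≤ n → (0 : ℝ) < w (π k) := fun k h1 hk => by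
    have := hπ.mapsTo (Set.mem_Icc.2 ⟨h1, hk⟩)
    exact_mod_cast hwpos _ this.1 this.2
  have key := sum_prefix_le_sum (g := fun i => (p i : ℝ) - r * w i) hπ hfn
    (fun k h1 hk => by
      have h := le_of_le_succ_of_le hsorted h1 hk.le hfn
      rw [div_le_iff₀ (hwπ k h1 (hk.le.trans hfn))] at h
      exact sub_nonpos.2 h)
    (fun k h1 hfk hk => by
      have h := le_of_le_succ_of_le hsorted hf1 hfk hk
      rw [le_div_iff₀ (hwπ k h1 hk)] at h
      exact sub_nonneg.2 h)
    hS.1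
  simp only [Finset.sum_sub_distrib, ← Finset.mul_sum] at key
  have hprofit : ∑ i ∈ Finset.Icc 1 (f - 1), (p (π i) : ℝ)
      + (((c : ℝ) - w b + 1 - ∑ i ∈ Finset.Icc 1 (f - 1), (w (π i) : ℝ)) / (w (π f) : ℝ))
          * (p (π f) : ℝ) ≤ ∑ i ∈ S, (p i : ℝ) := by
    rw [div_mul_eq_mul_div, mul_div_assoc, ← hr]
    linarith [mul_le_mul_of_nonneg_left hW hr0]
  exact (div_le_div_of_nonneg_right hprofit hUBpos.le).trans
    (div_le_div_of_nonneg_left (by positivity) hTpos hUB)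
end

section
/- Let x be an inclusionwise maximal solution and define M = max{∑_{i=1}^{g-1} w_{m_{i-1}+1} n_i : n_1, ..., n_{g-1} integers with 0 ≤ n_i ≤ s_i for all i and ∑_{i=1}^{g-1} w_{m_i} n_i ≤ c}. Define z = min{a ∈ {0, 1, ..., s_g} : ∑_{i=m_{g-1}+1}^{m_{g-1}+a} w_i > c - M - w_{m_{g-1}+1}} if this set is nonempty, and z = s_g otherwise. Then l_g ≥ z. -/
/-- The set of attainable values `∑_{i=1}^{g-1} w_{m_{i-1}+1} n_i` over integer vectors
`0 ≤ n_i ≤ s_i` (where `s_i = m_i - m_{i-1}`) with `∑_{i=1}^{g-1} w_{m_i} n_i ≤ c`. -/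
def MSet (c g : ℕ) (w m : ℕ → ℕ) : Set ℕ :=
  {t : ℕ | ∃ nv : ℕ → ℕ,
    (∀ i, 1 ≤ i → i ≤ g - 1 → nv i ≤ m i - m (i - 1)) ∧
    (∑ i ∈ Finset.Icc 1 (g - 1), w (m i) * nv i) ≤ c ∧
    t = ∑ i ∈ Finset.Icc 1 (g - 1), w (m (i - 1) + 1) * nv i}

/-- The set `{a ∈ {0,1,…,s_g} : ∑_{i=m_{g-1}+1}^{m_{g-1}+a} w_i > c - M - w_{m_{g-1}+1}}`. -/
def ZSet (c g : ℕ) (w m : ℕ → ℕ) (M : ℕ) : Set ℕ :=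
  {a : ℕ | a ≤ m g - m (g - 1) ∧
    (c : ℤ) - M - w (m (g - 1) + 1)
      < ∑ i ∈ Finset.Icc (m (g - 1) + 1) (m (g - 1) + a), (w i : ℤ)}

open Finset in
/-- For a weight that is antitone on `Icc (a + 1) b`, the total weight of a subset is at most that
of an initial segment with the same number of elements. -/
lemma sum_le_sum_Icc_card_of_antitone (w : ℕ → ℕ) (a b : ℕ)
    (hw : ∀ i j, a + 1 ≤ i → i ≤ j → j ≤ b → w j ≤ w i) (T : Finset ℕ)
    (hT : T ⊆ Icc (a + 1) b) :
    ∑ i ∈ T, w i ≤ ∑ i ∈ Icc (a + 1) (a + #T), w i := by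
  induction T using Finset.induction_on_max with
  | empty => simp
  | insert x s hx ih =>
    have hxs : x ∉ s := fun h => lt_irrefl _ (hx x h)
    have hs : s ⊆ Icc (a + 1) b := (subset_insert x s).trans hT
    have hxb := mem_Icc.1 (hT (mem_insert_self x s))
    have hcard : #s ≤ x - (a + 1) := by
      have : s ⊆ Ico (a + 1) x := fun i hi =>
        mem_Ico.2 ⟨(mem_Icc.1 (hs hi)).1, hx i hi⟩
      simpa using card_le_card this
    rw [sum_insert hxs, card_insert_of_notMem hxs, ← add_assoc a,
      sum_Icc_succ_top (by omega), add_comm]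
    exact add_le_add (ih hs) (hw _ _ (by omega) (by omega) hxb.2)

open Finset in
/-- Summing over consecutive blocks is the same as summing over their union. -/
lemma sum_Icc_eq_sum_sum_blocks (f m : ℕ → ℕ) (hm0 : m 0 = 0) (k : ℕ)
    (hm : ∀ i, i < k → m i ≤ m (i + 1)) :
    ∑ j ∈ Icc 1 (m k), f j = ∑ i ∈ Icc 1 k, ∑ j ∈ Icc (m (i - 1) + 1) (m i), f j := by
  induction k with
  | zero => simp [hm0]
  | succ k ih =>
    rw [sum_Icc_succ_top (by omega), ← ih fun i hi => hm i (by omega), Nat.add_sub_cancel]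
    have h := sum_Ioc_consecutive f (Nat.zero_le _) (hm k (by omega))
    simpa only [← Icc_add_one_left_eq_Ioc, zero_add] using h.symm

theorem stmt_10 (n c : ℕ) (w p : ℕ → ℕ)
    (hn : 1 ≤ n) (hc : 1 ≤ c)
    (hwpos : ∀ i, 1 ≤ i → i ≤ n → 1 ≤ w i)
    (hppos : ∀ i, 1 ≤ i → i ≤ n → 1 ≤ p i)
    (hmono : ∀ i j, 1 ≤ i → i ≤ j → j ≤ n → w j ≤ w i)
    (hsum : c < ∑ i ∈ Finset.Icc 1 n, w i)
    (hwle : ∀ i, 1 ≤ i → i ≤ n → w i ≤ c)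
    -- a partition of `{1,…,n}` into `g` groups of consecutive indices
    (g : ℕ) (hg : 2 ≤ g) (m : ℕ → ℕ)
    (hm0 : m 0 = 0) (hmg : m g = n) (hmlt : ∀ i, i < g → m i < m (i + 1))
    -- `M` is the maximum defining the cardinality bound
    (M : ℕ) (hM : IsGreatest (MSet c g w m) M)
    -- `z` is the minimum of `ZSet` if it is nonempty, and `s_g` otherwise
    (z : ℕ)
    (hz1 : (ZSet c g w m M).Nonempty → IsLeast (ZSet c g w m M) z)
    (hz2 : ¬ (ZSet c g w m M).Nonempty → z = m g - m (g - 1))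
    -- an inclusionwise maximal solution
    (S : Finset ℕ) (hS : IsIMS n c w S) :
    z ≤ ((Finset.Icc (m (g - 1) + 1) (m g)).filter (· ∈ S)).card := by
  obtain ⟨hSn, hSc, hSmax⟩ := hS
  set L : ℕ → Finset ℕ := fun i => (Finset.Icc (m (i - 1) + 1) (m i)).filter (· ∈ S) with hL
  change z ≤ (L g).card
  have hmle : ∀ i j, i ≤ j → j ≤ g → m i ≤ m j := by
    intro i j hij
    induction j, hij using Nat.le_induction with
    | base => exact fun _ => le_rfl
    | succ j _ ih => exact fun hj => (ih (by omega)).trans (hmlt j (by omega)).le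
  have hcard : ∀ i, (L i).card ≤ m i - m (i - 1) := fun i => by
    simpa using Finset.card_filter_le (Finset.Icc (m (i - 1) + 1) (m i)) (· ∈ S)
  have hzle : z ≤ m g - m (g - 1) := by
    by_cases h : (ZSet c g w m M).Nonempty
    · exact (hz1 h).1.1
    · exact (hz2 h).le
  by_cases hfull : ∃ j ∈ Finset.Icc (m (g - 1) + 1) (m g), j ∉ S
  swap
  · push Not at hfull
    have : L g = Finset.Icc (m (g - 1) + 1) (m g) := Finset.filter_true_of_mem hfull
    rw [this]
    simpa using hzle
  obtain ⟨j, hj, hjS⟩ := hfull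
  rw [Finset.mem_Icc] at hj
  have hexceeds : c < w j + totalWeight w S := by
    by_contra! h
    exact hSmax ⟨j, by omega, by omega, hjS, h⟩
  have hsplit : totalWeight w S =
      (∑ i ∈ Finset.Icc 1 (g - 1), ∑ j ∈ L i, w j) + ∑ j ∈ L g, w j := by
    have hS : totalWeight w S = ∑ j ∈ Finset.Icc 1 (m g), if j ∈ S then w j else 0 := by
      rw [← Finset.sum_filter, hmg, Finset.filter_mem_eq_inter, Finset.inter_eq_right.2 hSn]
      rfl
    rw [hS, sum_Icc_eq_sum_sum_blocks _ m hm0 g fun i hi => (hmlt i hi).le]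
    simp only [← Finset.sum_filter]
    obtain ⟨k, rfl⟩ : ∃ k, g = k + 1 := ⟨g - 1, by omega⟩
    rw [Finset.sum_Icc_succ_top (by omega)]
    rfl
  have hupper : ∑ i ∈ Finset.Icc 1 (g - 1), ∑ j ∈ L i, w j ≤
      ∑ i ∈ Finset.Icc 1 (g - 1), w (m (i - 1) + 1) * (L i).card := by
    refine Finset.sum_le_sum fun i hi => ?_
    rw [Finset.mem_Icc] at hi
    rw [mul_comm]
    refine Finset.sum_le_card_nsmul _ _ _ fun j hj => ?_
    have hj := Finset.mem_Icc.1 (Finset.mem_filter.1 hj).1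
    have := hmle i g (by omega) le_rfl
    exact hmono _ _ (by omega) hj.1 (by omega)
  have hlower : ∑ i ∈ Finset.Icc 1 (g - 1), w (m i) * (L i).card ≤
      ∑ i ∈ Finset.Icc 1 (g - 1), ∑ j ∈ L i, w j := by
    refine Finset.sum_le_sum fun i hi => ?_
    rw [Finset.mem_Icc] at hi
    rw [mul_comm]
    refine Finset.card_nsmul_le_sum _ _ _ fun j hj => ?_
    have hj := Finset.mem_Icc.1 (Finset.mem_filter.1 hj).1
    have := hmle i g (by omega) le_rfl
    exact hmono _ _ (by omega) hj.2 (by omega)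
  have hheadM : ∑ i ∈ Finset.Icc 1 (g - 1), w (m (i - 1) + 1) * (L i).card ≤ M :=
    hM.2 ⟨fun i => (L i).card, fun i _ _ => hcard i, hlower.trans (by omega), rfl⟩
  have htail := sum_le_sum_Icc_card_of_antitone w (m (g - 1)) (m g)
    (fun i j hi hij hj => hmono i j (by omega) hij (by omega)) (L g) (Finset.filter_subset _ _)
  have hwj := hmono (m (g - 1) + 1) j (by omega) hj.1 (by omega)
  have hmem : (L g).card ∈ ZSet c g w m M := by
    refine ⟨hcard g, ?_⟩
    rw [← Nat.cast_sum]
    omega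
  exact (hz1 ⟨_, hmem⟩).2 hmem
end
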